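/- Let W_k : ℝⁿ × ℝⁿ × ℝⁿ → ℝ (k = 1, …, m) be convex and let f(·, t) : ℝⁿ → ℝ be convex and differentiable. Let x̃, x : [0,1] → ℝⁿ be twice differentiable arcs, fix t ∈ [0,1], and suppose: W_k(x(t), x'(t), x''(t)) ≤ 0 for every k; there exist reals α_k ≥ 0 and subgradients s_k ∈ ∂W_k(x̃(t), x̃'(t), x̃''(t)) with α_k · W_k(x̃(t), x̃'(t), x̃''(t)) = 0 for every k; and x*, ψ* : [0,1] → ℝⁿ (x* twice differentiable, ψ* differentiable at t) satisfy (x*''(t) + ψ*'(t) − ∇f(x̃(t), t), ψ*(t), −x*(t)) = ∑_{k=1}^m α_k s_k. Then f(x(t), t) − f(x̃(t), t) ≥ ⟨x*''(t), x(t) − x̃(t)⟩ − ⟨x*(t), x''(t) − x̃''(t)⟩ + ⟨ψ*'(t), x(t) − x̃(t)⟩ + ⟨ψ*(t), x'(t) − x̃'(t)⟩. -/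

import Mathlib

open scoped RealInnerProductSpace
open Set MeasureTheory

noncomputable section

abbrev E (n : ℕ) := EuclideanSpace ℝ (Fin n)

/-- The product inner product on `ℝⁿ × ℝⁿ × ℝⁿ`. -/
def inner3 {n : ℕ} (a b : E n × E n × E n) : ℝ :=
  ⟪a.1, b.1⟫ + ⟪a.2.1, b.2.1⟫ + ⟪a.2.2, b.2.2⟫

/-- `s` is a subgradient of `g : ℝⁿ × ℝⁿ × ℝⁿ → ℝ` at `x`. -/
def IsSubgrad3 {n : ℕ} (g : E n × E n × E n → ℝ) (x s : E n × E n × E n) : Prop :=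
  ∀ y, g y - g x ≥ inner3 s (y - x)

/-- The product inner product on `ℝⁿ × ℝⁿ`. -/
def inner2 {n : ℕ} (a b : E n × E n) : ℝ :=
  ⟪a.1, b.1⟫ + ⟪a.2, b.2⟫

/-- `s` is a subgradient of `g : ℝⁿ × ℝⁿ → ℝ` at `x`. -/
def IsSubgrad2 {n : ℕ} (g : E n × E n → ℝ) (x s : E n × E n) : Prop :=
  ∀ y, g y - g x ≥ inner2 s (y - x)

/-- `s` is a subgradient of `g : ℝⁿ → ℝ` at `x`. -/
def IsSubgrad1 {n : ℕ} (g : E n → ℝ) (x s : E n) : Prop :=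
  ∀ y, g y - g x ≥ ⟪s, y - x⟫

/-- The first-order characterization of convexity: the gradient is a subgradient. -/
theorem ConvexOn.inner_gradient_le_sub {F : Type*} [NormedAddCommGroup F] [InnerProductSpace ℝ F]
    [CompleteSpace F] {f : F → ℝ} (hf : ConvexOn ℝ univ f) {x : F} (hx : DifferentiableAt ℝ f x)
    (y : F) : ⟪gradient f x, y - x⟫ ≤ f y - f x := by
  have hconv : ConvexOn ℝ univ (f ∘ AffineMap.lineMap (k := ℝ) x y) := by
    simpa using hf.comp_affineMap (AffineMap.lineMap (k := ℝ) x y)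
  have hgrad : HasFDerivAt f (InnerProductSpace.toDual ℝ F (gradient f x))
      (AffineMap.lineMap (k := ℝ) x y 0) := by
    simpa using hx.hasGradientAt.hasFDerivAt
  have hderiv : HasDerivAt (f ∘ AffineMap.lineMap (k := ℝ) x y) ⟪gradient f x, y - x⟫ 0 := by
    simpa using hgrad.comp_hasDerivAt (0 : ℝ) AffineMap.hasDerivAt_lineMap
  have h := hconv.le_slope_of_hasDerivAt (mem_univ 0) (mem_univ 1) one_pos hderiv
  simpa [slope_def_field] using h

theorem inner3_sum_smul_left {n : ℕ} {ι : Type*} (t : Finset ι) (α : ι → ℝ)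
    (s : ι → E n × E n × E n) (b : E n × E n × E n) :
    inner3 (∑ k ∈ t, α k • s k) b = ∑ k ∈ t, α k * inner3 (s k) b := by
  simp only [inner3, Prod.fst_sum, Prod.snd_sum, Prod.smul_fst, Prod.smul_snd, sum_inner,
    real_inner_smul_left, mul_add, Finset.sum_add_distrib]

theorem stmt17 (n m : ℕ)
    (W : Fin m → E n × E n × E n → ℝ) (hWconv : ∀ k, ConvexOn ℝ univ (W k))
    (f : E n → ℝ) (hfconv : ConvexOn ℝ univ f) (hfdiff : Differentiable ℝ f)
    -- values at the fixed time t of x, x', x'', x̃, x̃', x̃'', x*, x*'', ψ*, ψ*'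
    (xt x't x''t xtt xtt' xtt'' Xt X''t Pt P't : E n)
    (hxfeas : ∀ k, W k (xt, x't, x''t) ≤ 0)
    (α : Fin m → ℝ) (hα : ∀ k, 0 ≤ α k)
    (sk : Fin m → E n × E n × E n)
    (hsk : ∀ k, IsSubgrad3 (W k) (xtt, xtt', xtt'') (sk k))
    (hcs : ∀ k, α k * W k (xtt, xtt', xtt'') = 0)
    (heq : (X''t + P't - gradient f xtt, Pt, -Xt) = ∑ k, α k • sk k) :
    f xt - f xtt ≥
      ⟪X''t, xt - xtt⟫ - ⟪Xt, x''t - xtt''⟫ + ⟪P't, xt - xtt⟫ + ⟪Pt, x't - xtt'⟫ := by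
  have hsum : inner3 (∑ k, α k • sk k) ((xt, x't, x''t) - (xtt, xtt', xtt'')) ≤ 0 := by
    rw [inner3_sum_smul_left]
    refine Finset.sum_nonpos fun k _ => ?_
    have hsub := mul_le_mul_of_nonneg_left (hsk k (xt, x't, x''t)) (hα k)
    have hfeas := mul_nonpos_of_nonneg_of_nonpos (hα k) (hxfeas k)
    linarith [hcs k, mul_sub (α k) (W k (xt, x't, x''t)) (W k (xtt, xtt', xtt''))]
  rw [← heq] at hsum
  simp only [inner3, Prod.mk_sub_mk, inner_neg_left, inner_sub_left (X''t + P't),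
    inner_add_left] at hsum
  linarith [hfconv.inner_gradient_le_sub (hfdiff xtt) xt]
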